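/- Suppose θ(ζ₀) < ∞ and θ(ζ) > 0 for all ζ. If {x(ζ)} is an eventually positive solution of equation (1.1) with x(ζ−σ) > 0 and Δx(ζ) < 0 for all ζ ≥ ζ₁, then the sequence u(ζ) := r(ζ)(Δx(ζ))^α / x^α(ζ−σ) satisfies −1 ≤ θ(ζ)·u^{1/α}(ζ) < 0 for all sufficiently large ζ. -/

import Mathlib

open Filter Finset

/-- The real `n`-th root, extended to negative reals as an odd function
(this is the genuine real `n`-th root when `n` is odd). -/
noncomputable def oddRoot (n : ℕ) (t : ℝ) : ℝ :=
  if t < 0 then -((-t) ^ ((n : ℝ))⁻¹) else t ^ ((n : ℝ))⁻¹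

/-- `ratPow p n t` is the rational power `t ^ (p / n)`, defined for all real `t`
when the denominator `n` is odd. -/
noncomputable def ratPow (p : ℤ) (n : ℕ) (t : ℝ) : ℝ := oddRoot n t ^ p

/-- Forward difference operator: `fwd x ζ = x (ζ+1) - x ζ`. -/
def fwd (x : ℤ → ℝ) (ζ : ℤ) : ℝ := x (ζ + 1) - x ζ

/-- `theta α r ζ = ∑_{s=ζ}^∞ (r s) ^ (-1/α)`. -/
noncomputable def theta (α : ℝ) (r : ℤ → ℝ) (ζ : ℤ) : ℝ :=
  ∑' k : ℕ, (r (ζ + k) ^ α⁻¹)⁻¹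

/-- A real sequence is eventually positive. -/
def EvPos (x : ℤ → ℝ) : Prop := ∃ N : ℤ, ∀ ζ ≥ N, 0 < x ζ

/-- A real sequence is eventually negative. -/
def EvNeg (x : ℤ → ℝ) : Prop := ∃ N : ℤ, ∀ ζ ≥ N, x ζ < 0

/-- A sequence oscillates if it is neither eventually positive nor eventually negative. -/
def Oscillates (x : ℤ → ℝ) : Prop := ¬ EvPos x ∧ ¬ EvNeg x

lemma ratPow_of_nonneg (m n : ℕ) {t : ℝ} (ht : 0 ≤ t) :
    ratPow m n t = t ^ ((m : ℝ) / n) := by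
  rw [ratPow, oddRoot, if_neg (not_lt.mpr ht), zpow_natCast, ← Real.rpow_natCast,
    ← Real.rpow_mul ht]
  congr 1
  ring

lemma ratPow_of_neg {m : ℕ} (hm : Odd m) (n : ℕ) {t : ℝ} (ht : t < 0) :
    ratPow m n t = -((-t) ^ ((m : ℝ) / n)) := by
  rw [ratPow, oddRoot, if_pos ht, zpow_natCast, hm.neg_pow, ← Real.rpow_natCast,
    ← Real.rpow_mul (by linarith)]
  congr 2
  ring

/-- If `r (-Δx)^α` is nondecreasing from `ζ` on, where `x` is positive and decreasing, then
`θ(ζ)` times the quasi-difference `r^{1/α} (-Δx)` at `ζ` is at most `x(ζ)`. -/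
lemma theta_mul_le {α : ℝ} (hα : 0 < α) {r x : ℤ → ℝ} (hr : ∀ ζ, 0 < r ζ) {ζ : ℤ}
    (hpos : ∀ s ≥ ζ, 0 < x s) (hdec : ∀ s ≥ ζ, fwd x s < 0)
    (hmono : ∀ s ≥ ζ, r s * (-fwd x s) ^ α ≤ r (s + 1) * (-fwd x (s + 1)) ^ α) :
    theta α r ζ * (r ζ ^ α⁻¹ * -fwd x ζ) ≤ x ζ := by
  have hroot : ∀ s ≥ ζ, (r s * (-fwd x s) ^ α) ^ α⁻¹ = r s ^ α⁻¹ * -fwd x s := by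
    intro s hs
    have hy : 0 ≤ -fwd x s := by linarith [hdec s hs]
    rw [Real.mul_rpow (hr s).le (Real.rpow_nonneg hy _), Real.rpow_rpow_inv hy hα.ne']
  have hstep : ∀ s ≥ ζ, r s ^ α⁻¹ * -fwd x s ≤ r (s + 1) ^ α⁻¹ * -fwd x (s + 1) := by
    intro s hs
    rw [← hroot s hs, ← hroot (s + 1) (by omega)]
    have hy : 0 ≤ -fwd x s := by linarith [hdec s hs]
    exact Real.rpow_le_rpow (mul_nonneg (hr s).le (Real.rpow_nonneg hy _)) (hmono s hs)
      (inv_nonneg.mpr hα.le)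
  set w := r ζ ^ α⁻¹ * -fwd x ζ with hw
  have hw0 : 0 < w := mul_pos (Real.rpow_pos_of_pos (hr ζ) _) (by linarith [hdec ζ le_rfl])
  have hle : ∀ k : ℕ, w ≤ r (ζ + k) ^ α⁻¹ * -fwd x (ζ + k) := by
    intro k
    induction k with
    | zero => simp [hw]
    | succ k ih =>
      have h := hstep (ζ + k) (by omega)
      push_cast
      rw [← add_assoc]
      exact ih.trans h
  have hsum : ∀ n : ℕ, (∑ k ∈ range n, (r (ζ + k) ^ α⁻¹)⁻¹) * w ≤ x ζ - x (ζ + n) := by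
    intro n
    induction n with
    | zero => simp
    | succ n ih =>
      have hR : 0 < r (ζ + n) ^ α⁻¹ := Real.rpow_pos_of_pos (hr _) _
      have h : (r (ζ + n) ^ α⁻¹)⁻¹ * w ≤ -fwd x (ζ + n) := by
        rw [inv_mul_le_iff₀ hR]
        exact hle n
      rw [sum_range_succ, add_mul]
      push_cast
      rw [← add_assoc]
      rw [fwd] at h
      linarith
  rw [← le_div_iff₀ hw0]
  refine Real.tsum_le_of_sum_range_le (fun k => (inv_pos.mpr (Real.rpow_pos_of_pos (hr _) _)).le)
    fun n => ?_
  rw [le_div_iff₀ hw0]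
  linarith [hsum n, hpos (ζ + n) (by omega)]

/-- Suppose `θ(ζ₀) < ∞` and `θ(ζ) > 0` for all `ζ`. If `x` is an
eventually positive solution of (1.1) with `x(ζ-σ) > 0` and `Δx(ζ) < 0` for all
`ζ ≥ ζ₁`, then `u(ζ) = r(ζ)(Δx(ζ))^α / x^α(ζ-σ)` satisfies
`-1 ≤ θ(ζ)·u^{1/α}(ζ) < 0` for all sufficiently large `ζ`. -/
theorem statement11
    (m n : ℕ) (α : ℝ) (hm : Odd m) (hn : Odd n) (hmn : Nat.Coprime m n)
    (hm0 : 0 < m) (hn0 : 0 < n) (hα : α = (m : ℝ) / n)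
    (ζ₀ σ : ℤ) (hσ : 0 ≤ σ)
    (r q : ℤ → ℝ) (hr : ∀ ζ, 0 < r ζ) (hq : ∀ ζ, 0 ≤ q ζ)
    (hq0 : ∀ N : ℤ, ∃ ζ ≥ N, q ζ ≠ 0)
    (hθ : Summable (fun k : ℕ => (r (ζ₀ + k) ^ α⁻¹)⁻¹))
    (hθpos : ∀ ζ : ℤ, 0 < theta α r ζ)
    (x : ℤ → ℝ)
    (hsol : ∀ ζ ≥ ζ₀, fwd (fun t => r t * ratPow m n (fwd x t)) ζ
        + q ζ * ratPow m n (x (ζ - σ)) = 0)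
    (ζ₁ : ℤ) (hζ₁ : ζ₁ ≥ ζ₀)
    (hpos : ∀ ζ ≥ ζ₁, 0 < x ζ)
    (hposd : ∀ ζ ≥ ζ₁, 0 < x (ζ - σ))
    (hdec : ∀ ζ ≥ ζ₁, fwd x ζ < 0)
    (u : ℤ → ℝ)
    (hu : ∀ ζ, u ζ = r ζ * ratPow m n (fwd x ζ) / ratPow m n (x (ζ - σ))) :
    ∃ N : ℤ, ∀ ζ ≥ N,
      -1 ≤ theta α r ζ * ratPow (n : ℤ) m (u ζ) ∧
      theta α r ζ * ratPow (n : ℤ) m (u ζ) < 0 := by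
  have hα0 : 0 < α := by rw [hα]; positivity
  have hαinv : (n : ℝ) / m = α⁻¹ := by rw [hα, inv_div]
  have hanti : ∀ k : ℕ, ∀ ζ ≥ ζ₁, x (ζ + k) ≤ x ζ := by
    intro k ζ hζ
    induction k with
    | zero => simp
    | succ k ih =>
      have h := hdec (ζ + k) (by omega)
      rw [fwd] at h
      push_cast
      rw [← add_assoc]
      linarith
  have hmono : ∀ s ≥ ζ₁, r s * (-fwd x s) ^ α ≤ r (s + 1) * (-fwd x (s + 1)) ^ α := by
    intro s hs
    have h := hsol s (by omega)
    rw [fwd] at h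
    simp only [ratPow_of_neg hm n (hdec s hs), ratPow_of_neg hm n (hdec (s + 1) (by omega)),
      ratPow_of_nonneg m n (hposd s hs).le, ← hα] at h
    have := mul_nonneg (hq s) (Real.rpow_nonneg (hposd s hs).le α)
    linarith
  refine ⟨ζ₁ + σ, fun ζ hζ => ?_⟩
  have hζ' : ζ ≥ ζ₁ := by omega
  have hy : 0 < -fwd x ζ := by linarith [hdec ζ hζ']
  have hX := hposd ζ hζ'
  have hu' : u ζ = -(r ζ * (-fwd x ζ) ^ α / x (ζ - σ) ^ α) := by
    rw [hu, ratPow_of_neg hm n (hdec ζ hζ'), ratPow_of_nonneg m n hX.le, ← hα]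
    ring
  have hrY : 0 < r ζ * (-fwd x ζ) ^ α := mul_pos (hr ζ) (Real.rpow_pos_of_pos hy _)
  have hXα : 0 < x (ζ - σ) ^ α := Real.rpow_pos_of_pos hX _
  have huroot : ratPow (n : ℤ) m (u ζ) = -(r ζ ^ α⁻¹ * -fwd x ζ / x (ζ - σ)) := by
    have hneg : u ζ < 0 := by
      rw [hu']
      exact neg_neg_of_pos (div_pos hrY hXα)
    rw [ratPow_of_neg hn m hneg, hu', neg_neg, hαinv, Real.div_rpow hrY.le hXα.le,
      Real.mul_rpow (hr ζ).le (Real.rpow_nonneg hy.le _), Real.rpow_rpow_inv hy.le hα0.ne',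
      Real.rpow_rpow_inv hX.le hα0.ne']
  have hw : 0 < r ζ ^ α⁻¹ * -fwd x ζ := mul_pos (Real.rpow_pos_of_pos (hr ζ) _) hy
  rw [huroot]
  constructor
  · have hle := theta_mul_le hα0 hr (fun s hs => hpos s (by omega)) (fun s hs => hdec s (by omega))
      (fun s hs => hmono s (by omega)) (ζ := ζ)
    have hdelay : x ζ ≤ x (ζ - σ) := by
      have h := hanti σ.toNat (ζ - σ) (by omega)
      rwa [Int.toNat_of_nonneg hσ, sub_add_cancel] at h
    rw [mul_neg, neg_le_neg_iff, ← mul_div_assoc, div_le_one hX]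
    exact hle.trans hdelay
  · exact mul_neg_of_pos_of_neg (hθpos ζ) (neg_neg_of_pos (div_pos hw hX))
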